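/- (Lifting property for twisted involutions.) Let s ∈ S and u,w ∈ I(θ) with u ≤ w in the Bruhat order, and suppose s ∈ D_R(w). Then: (i) u·s̲ ≤ w; (ii) if s ∈ D_R(u), then u·s̲ ≤ w·s̲; (iii) if s ∉ D_R(u), then u ≤ w·s̲. -/

import Mathlib

namespace TwistedIdentitiesPaper

open scoped Classical

variable {B : Type*} {W : Type*} [Group W] {M : CoxeterMatrix B}

/-- The Bruhat order on `W`, defined via the subword property: `u ≤ v` iff every
reduced expression for `v` contains a subword representing `u`. -/
def bruhatLE (cs : CoxeterSystem M W) (u v : W) : Prop :=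
  ∀ l : List B, cs.IsReduced l → cs.wordProd l = v →
    ∃ l' : List B, l'.Sublist l ∧ cs.wordProd l' = u

/-- The strict Bruhat order. -/
def bruhatLT (cs : CoxeterSystem M W) (u v : W) : Prop :=
  bruhatLE cs u v ∧ u ≠ v

/-- The action `w ↦ w ⋅ s̲ᵢ`: `w ⋅ s̲ᵢ = w sᵢ` if `θ(sᵢ) w sᵢ = w`, and
`w ⋅ s̲ᵢ = θ(sᵢ) w sᵢ` otherwise. -/
noncomputable def twistAct (cs : CoxeterSystem M W) (θ : W ≃* W) (w : W) (i : B) : W :=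
  if θ (cs.simple i) * w * cs.simple i = w then w * cs.simple i
  else θ (cs.simple i) * w * cs.simple i

/-- `e ⋅ s̲₁ ⋯ s̲ₖ` for a word `s₁ ⋯ sₖ`. -/
noncomputable def twistProd (cs : CoxeterSystem M W) (θ : W ≃* W) (l : List B) : W :=
  l.foldl (twistAct cs θ) 1

/-- The set of twisted involutions `I(θ) = {w : θ(w) = w⁻¹}`. -/
def twistedInvolutions (θ : W ≃* W) : Set W := {w | θ w = w⁻¹}

/-- The set of twisted identities `ι(θ) = {θ(w⁻¹) w : w ∈ W}`. -/
def twistedIdentities (θ : W ≃* W) : Set W := {w | ∃ v : W, w = θ v⁻¹ * v}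

/-- The rank `ρ(w)` of a twisted involution: the least `k` such that
`w = e ⋅ s̲₁ ⋯ s̲ₖ`. -/
noncomputable def twistRank (cs : CoxeterSystem M W) (θ : W ≃* W) (w : W) : ℕ :=
  sInf {k | ∃ l : List B, l.length = k ∧ twistProd cs θ l = w}

/-- `θ` has the no-odd-flip (NOF) property: for every `s ∈ S` with `θ(s) ≠ s`,
the order of `s θ(s)` is even or infinite. -/
def NOF (cs : CoxeterSystem M W) (θ : W ≃* W) : Prop :=
  ∀ i : B, θ (cs.simple i) ≠ cs.simple i →
    Even (orderOf (cs.simple i * θ (cs.simple i))) ∨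
      orderOf (cs.simple i * θ (cs.simple i)) = 0


/-- The involution `(t, ε) ↦ (s t s, ε + [t = s])` of `W × ZMod 2` attached to a simple
reflection `s`. -/
noncomputable def signedConj (cs : CoxeterSystem M W) (i : B) : Equiv.Perm (W × ZMod 2) :=
  Function.Involutive.toPerm
    (fun p => (cs.simple i * p.1 * cs.simple i, p.2 + if p.1 = cs.simple i then 1 else 0)) <| by
    rintro ⟨t, ε⟩
    have h : cs.simple i * t * cs.simple i = cs.simple i ↔ t = cs.simple i := by
      constructor
      · intro h
        have := congrArg (fun x => cs.simple i * x * cs.simple i) h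
        simpa [mul_assoc] using this
      · rintro rfl
        simp
    have h2 : (1 : ZMod 2) + 1 = 0 := by decide
    refine Prod.ext (by simp [mul_assoc]) ?_
    by_cases ht : t = cs.simple i <;> simp [h, ht, add_assoc, h2]

theorem signedConj_apply (cs : CoxeterSystem M W) (i : B) (p : W × ZMod 2) :
    signedConj cs i p =
      (cs.simple i * p.1 * cs.simple i, p.2 + if p.1 = cs.simple i then 1 else 0) := rfl

theorem simple_mul_mul_pow (cs : CoxeterSystem M W) (i j : B) (n : ℕ) :
    (cs.simple i * cs.simple j) ^ n * (cs.simple j * (cs.simple i * cs.simple j) ^ n) =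
      cs.simple j := by
  induction n with
  | zero => simp
  | succ n ih =>
    have h : ∀ y, cs.simple i * cs.simple j * (cs.simple j * (cs.simple i * cs.simple j * y)) =
        cs.simple j * y := fun y => by simp [mul_assoc]
    nth_rewrite 2 [pow_succ']
    rw [pow_succ, mul_assoc, h, ih]

theorem signedConj_mul_pow_apply (cs : CoxeterSystem M W) (i j : B) (n : ℕ) (t : W)
    (ε : ZMod 2) :
    ((signedConj cs i * signedConj cs j) ^ n) (t, ε) =
      ((cs.simple i * cs.simple j) ^ n * t * ((cs.simple i * cs.simple j) ^ n)⁻¹,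
        ε + ∑ k ∈ Finset.range (2 * n),
          if t = cs.simple j * (cs.simple i * cs.simple j) ^ k then 1 else 0) := by
  induction n with
  | zero => simp
  | succ n ih =>
    have key := simple_mul_mul_pow cs i j n
    rw [pow_succ', Equiv.Perm.mul_apply, ih, Equiv.Perm.mul_apply, signedConj_apply,
      signedConj_apply, show 2 * (n + 1) = 2 * n + 1 + 1 by ring, Finset.sum_range_succ,
      Finset.sum_range_succ]
    set x := cs.simple i * cs.simple j with hx
    have hxi : x⁻¹ = cs.simple j * cs.simple i := by simp [hx]
    have e1 : x ^ n * t * (x ^ n)⁻¹ = cs.simple j ↔ t = cs.simple j * x ^ (2 * n) := by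
      rw [mul_inv_eq_iff_eq_mul, two_mul, pow_add, ← mul_assoc]
      nth_rewrite 1 [← key]
      simp only [mul_assoc, mul_right_inj]
    have e2 : cs.simple j * (x ^ n * t * (x ^ n)⁻¹) * cs.simple j = cs.simple i ↔
        t = cs.simple j * x ^ (2 * n + 1) := by
      have : cs.simple j * (x ^ n * t * (x ^ n)⁻¹) * cs.simple j = cs.simple i ↔
          x ^ n * t * (x ^ n)⁻¹ = cs.simple j * x := by
        constructor
        · intro h
          have := congrArg (fun y => cs.simple j * y * cs.simple j) h
          simpa [mul_assoc, hx] using this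
        · intro h
          rw [h]
          simp [hx, mul_assoc]
      rw [this, mul_inv_eq_iff_eq_mul, show 2 * n + 1 = n + (1 + n) by ring, pow_add, pow_add]
      nth_rewrite 1 [← key]
      rw [pow_one, show x ^ n * (cs.simple j * x ^ n) * x * x ^ n =
        x ^ n * (cs.simple j * (x ^ n * (x * x ^ n))) by simp only [mul_assoc]]
      simp only [mul_right_inj]
    simp only [e1, e2]
    refine Prod.ext ?_ ?_
    · simp only [pow_succ' x n, mul_inv_rev, hxi]
      simp only [hx, mul_assoc]
    · simp only [add_assoc]

theorem isLiftable_signedConj (cs : CoxeterSystem M W) : M.IsLiftable (signedConj cs) := by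
  intro i j
  refine Equiv.ext fun ⟨t, ε⟩ => ?_
  have hx := cs.simple_mul_simple_pow i j
  rw [signedConj_mul_pow_apply, hx, two_mul, Finset.sum_range_add]
  simp only [pow_add, hx, one_mul, CharTwo.add_self_eq_zero]
  simp

/-- The action of `W` on `W × ZMod 2` in which simple reflections act by `signedConj`. -/
noncomputable def signedConjHom (cs : CoxeterSystem M W) : W →* Equiv.Perm (W × ZMod 2) :=
  cs.lift ⟨signedConj cs, isLiftable_signedConj cs⟩

theorem signedConjHom_simple (cs : CoxeterSystem M W) (i : B) :
    signedConjHom cs (cs.simple i) = signedConj cs i :=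
  cs.lift_apply_simple (isLiftable_signedConj cs) i

theorem signedConjHom_apply (cs : CoxeterSystem M W) (w t : W) (ε : ZMod 2) :
    signedConjHom cs w (t, ε) = (w * t * w⁻¹, (signedConjHom cs w (t, 0)).2 + ε) := by
  induction w using cs.simple_induction_left generalizing t ε with
  | one => simp
  | mul_simple_left w i ih =>
    rw [map_mul, Equiv.Perm.mul_apply, Equiv.Perm.mul_apply, ih, ih t 0, signedConjHom_simple,
      signedConj_apply, signedConj_apply]
    refine Prod.ext ?_ ?_
    · simp [mul_assoc]
    · simp only
      ring

theorem signedConjHom_self {cs : CoxeterSystem M W} {t : W} (ht : cs.IsReflection t) :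
    signedConjHom cs t (t, 0) = (t, 1) := by
  obtain ⟨v, i, rfl⟩ := ht
  set t := v * cs.simple i * v⁻¹ with ht
  have h1 : signedConjHom cs v⁻¹ (t, 0) = (cs.simple i, (signedConjHom cs v⁻¹ (t, 0)).2) := by
    conv_lhs => rw [signedConjHom_apply]
    simp [ht, mul_assoc]
  have h2 : signedConjHom cs v (cs.simple i, (signedConjHom cs v⁻¹ (t, 0)).2) = (t, 0) := by
    rw [← h1, ← Equiv.Perm.mul_apply, ← map_mul]
    simp
  conv_lhs => rw [ht, map_mul, map_mul]
  rw [Equiv.Perm.mul_apply, Equiv.Perm.mul_apply, h1, signedConjHom_simple, signedConj_apply]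
  rw [signedConjHom_apply] at h2 ⊢
  simp only [Prod.mk.injEq] at h2
  simp only [cs.simple_mul_simple_self, one_mul, if_true]
  exact Prod.ext h2.1 (by simp only [← add_assoc, h2.2, zero_add])

theorem exists_sublist_of_signedConjHom_ne_zero (cs : CoxeterSystem M W) (l : List B) (t : W)
    (h : (signedConjHom cs (cs.wordProd l) (t, 0)).2 ≠ 0) :
    ∃ l' : List B, l'.Sublist l ∧ l'.length + 1 = l.length ∧
      cs.wordProd l' = cs.wordProd l * t := by
  induction l with
  | nil => simp at h
  | cons a l ih =>
    by_cases h0 : (signedConjHom cs (cs.wordProd l) (t, 0)).2 = 0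
    · refine ⟨l, List.sublist_cons_self a l, rfl, ?_⟩
      rw [cs.wordProd_cons, map_mul, Equiv.Perm.mul_apply, signedConjHom_apply cs (cs.wordProd l),
        signedConjHom_simple, signedConj_apply] at h
      have h' : cs.wordProd l * t * (cs.wordProd l)⁻¹ = cs.simple a := by
        by_contra hne
        exact h (by simp [hne, h0])
      rw [mul_inv_eq_iff_eq_mul] at h'
      simp [cs.wordProd_cons, mul_assoc, h']
    · obtain ⟨l', hs, hl, hp⟩ := ih h0
      exact ⟨a :: l', hs.cons_cons a, by simp [hl], by simp [cs.wordProd_cons, hp, mul_assoc]⟩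

/-- The strong exchange property, for arbitrary (not necessarily reduced) words. -/
theorem strong_exchange (cs : CoxeterSystem M W) (l : List B) {t : W} (ht : cs.IsReflection t)
    (h : cs.length (cs.wordProd l * t) < cs.length (cs.wordProd l)) :
    ∃ l' : List B, l'.Sublist l ∧ l'.length + 1 = l.length ∧
      cs.wordProd l' = cs.wordProd l * t := by
  refine exists_sublist_of_signedConjHom_ne_zero cs l t fun h0 => ?_
  obtain ⟨m, hm, hmw⟩ := cs.exists_isReduced (cs.wordProd l * t)
  have h1 : (signedConjHom cs (cs.wordProd m) (t, 0)).2 ≠ 0 := by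
    rw [← hmw, map_mul, Equiv.Perm.mul_apply, signedConjHom_self ht, signedConjHom_apply, h0]
    simp
  obtain ⟨m', -, hm', hp⟩ := exists_sublist_of_signedConjHom_ne_zero cs m t h1
  rw [← hmw, mul_assoc, ht.mul_self, mul_one] at hp
  have := cs.length_wordProd_le m'
  rw [hp] at this
  rw [hmw, hm.eq] at h
  omega

theorem exists_isReduced_concat {cs : CoxeterSystem M W} {w : W} {i : B}
    (h : cs.IsRightDescent w i) :
    ∃ m : List B, cs.IsReduced m ∧ cs.wordProd m = w * cs.simple i ∧
      cs.IsReduced (m ++ [i]) ∧ cs.wordProd (m ++ [i]) = w := by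
  obtain ⟨m, hm, hmw⟩ := cs.exists_isReduced (w * cs.simple i)
  have hw : cs.wordProd (m ++ [i]) = w := by simp [cs.wordProd_append, ← hmw, mul_assoc]
  refine ⟨m, hm, hmw.symm, ?_, hw⟩
  have h1 := cs.isRightDescent_iff.mp h
  have h2 := hm.eq
  rw [← hmw] at h2
  unfold CoxeterSystem.IsReduced
  rw [hw, List.length_append, List.length_singleton]
  omega

/-- If `t` is a reflection shortening `w` and `s` is a right descent of `w`, then either
`w t = w s` or `w t s` is shorter than `w` by at least two. -/
theorem eq_or_length_mul_mul_simple {cs : CoxeterSystem M W} {w t : W} {i : B}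
    (h : cs.IsRightDescent w i) (ht : cs.IsReflection t) (hwt : cs.length (w * t) < cs.length w) :
    w * t = w * cs.simple i ∨ cs.length (w * t * cs.simple i) + 2 ≤ cs.length w := by
  obtain ⟨m, -, hmw, hr, hw⟩ := exists_isReduced_concat h
  rw [← hw] at hwt
  obtain ⟨l, hs, hl, hp⟩ := strong_exchange cs _ ht hwt
  rw [hw] at hp
  have hlen := hr.eq
  rw [hw] at hlen
  rw [List.length_append, List.length_singleton] at hlen hl
  obtain ⟨l₁, l₂, rfl, h₁, h₂⟩ := List.sublist_append_iff.mp hs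
  rcases List.sublist_singleton.mp h₂ with rfl | rfl
  · left
    have : l₁ = m := h₁.eq_of_length (by simpa using hl)
    rw [← hp, ← hmw, this, List.append_nil]
  · right
    rw [← hp, cs.wordProd_append, cs.wordProd_singleton, mul_assoc, cs.simple_mul_simple_self,
      mul_one]
    have := cs.length_wordProd_le l₁
    rw [List.length_append, List.length_singleton] at hl
    omega

/-- The relation `u = v t` with `t` a reflection and `ℓ(u) < ℓ(v)`. -/
def bruhatStep (cs : CoxeterSystem M W) (u v : W) : Prop :=
  ∃ t, cs.IsReflection t ∧ u = v * t ∧ cs.length u < cs.length v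

/-- The Bruhat order described by chains of reflections. -/
def bruhatChain (cs : CoxeterSystem M W) : W → W → Prop :=
  Relation.ReflTransGen (bruhatStep cs)

theorem exists_sublist_of_bruhatChain {cs : CoxeterSystem M W} {u : W} {l : List B}
    (h : bruhatChain cs u (cs.wordProd l)) :
    ∃ l' : List B, l'.Sublist l ∧ cs.wordProd l' = u := by
  induction h using Relation.ReflTransGen.head_induction_on with
  | refl => exact ⟨l, List.Sublist.refl l, rfl⟩
  | head hstep _ ih =>
    obtain ⟨t, ht, rfl, hlt⟩ := hstep
    obtain ⟨l', hs, rfl⟩ := ih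
    obtain ⟨l'', hs', -, hp⟩ := strong_exchange cs l' ht hlt
    exact ⟨l'', hs'.trans hs, hp⟩

theorem bruhatStep_mul_simple {cs : CoxeterSystem M W} {w : W} {i : B}
    (h : cs.length w < cs.length (w * cs.simple i)) : bruhatStep cs w (w * cs.simple i) :=
  ⟨cs.simple i, cs.isReflection_simple i, by simp [mul_assoc], h⟩

theorem bruhatStep.mul_simple {cs : CoxeterSystem M W} {x y : W} (h : bruhatStep cs x y) (i : B) :
    x * cs.simple i = y ∨ bruhatStep cs (x * cs.simple i) (y * cs.simple i) := by
  obtain ⟨t, ht, rfl, hlt⟩ := h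
  by_cases hty : y * t = y * cs.simple i
  · left
    simp [hty, mul_assoc]
  right
  have ht' : cs.IsReflection (cs.simple i * t * cs.simple i) := by
    simpa using ht.conj (cs.simple i)
  have heq : y * t * cs.simple i = y * cs.simple i * (cs.simple i * t * cs.simple i) := by
    simp [mul_assoc]
  refine ⟨_, ht', heq, ?_⟩
  have hne : cs.length (y * t * cs.simple i) ≠ cs.length (y * cs.simple i) := by
    rw [heq]
    exact ht'.length_mul_left_ne _
  have h1 := cs.length_mul_simple (y * t) i
  have h2 := cs.length_mul_simple y i
  by_cases hd : cs.IsRightDescent y i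
  · have h3 := (eq_or_length_mul_mul_simple hd ht hlt).resolve_left hty
    omega
  · have h3 := cs.not_isRightDescent_iff.mp hd
    omega

theorem bruhatChain.mul_simple {cs : CoxeterSystem M W} {v w : W} {i : B}
    (h : bruhatChain cs v w) (hw : cs.length w < cs.length (w * cs.simple i)) :
    bruhatChain cs (v * cs.simple i) (w * cs.simple i) := by
  induction h using Relation.ReflTransGen.head_induction_on with
  | refl => exact Relation.ReflTransGen.refl
  | head hstep hchain ih =>
    rcases hstep.mul_simple i with h | h
    · rw [h]
      exact hchain.tail (bruhatStep_mul_simple hw)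
    · exact ih.head h

theorem bruhatChain_of_sublist {cs : CoxeterSystem M W} {l l' : List B} (hl : cs.IsReduced l)
    (h : l'.Sublist l) : bruhatChain cs (cs.wordProd l') (cs.wordProd l) := by
  induction l using List.reverseRecOn generalizing l' with
  | nil =>
    rw [List.sublist_nil.mp h]
    exact Relation.ReflTransGen.refl
  | append_singleton l i ih =>
    have hr : cs.IsReduced l := by simpa using hl.take l.length
    have hlt : cs.length (cs.wordProd l) < cs.length (cs.wordProd l * cs.simple i) := by
      have h1 := hl.eq
      rw [cs.wordProd_append, cs.wordProd_singleton, List.length_append,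
        List.length_singleton] at h1
      rw [h1, hr.eq]
      omega
    obtain ⟨l₁, l₂, rfl, h₁, h₂⟩ := List.sublist_append_iff.mp h
    rw [cs.wordProd_append l, cs.wordProd_singleton]
    rcases List.sublist_singleton.mp h₂ with rfl | rfl
    · rw [List.append_nil]
      exact (ih hr h₁).tail (bruhatStep_mul_simple hlt)
    · rw [cs.wordProd_append, cs.wordProd_singleton]
      exact (ih hr h₁).mul_simple hlt

theorem bruhatLE_iff_bruhatChain {cs : CoxeterSystem M W} {u w : W} :
    bruhatLE cs u w ↔ bruhatChain cs u w := by
  constructor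
  · intro h
    obtain ⟨l, hl, rfl⟩ := cs.exists_isReduced w
    obtain ⟨l', hs, rfl⟩ := h l hl rfl
    exact bruhatChain_of_sublist hl hs
  · rintro h l - rfl
    exact exists_sublist_of_bruhatChain h

theorem bruhatLE_of_sublist {cs : CoxeterSystem M W} {l l' : List B} (hl : cs.IsReduced l)
    (h : l'.Sublist l) : bruhatLE cs (cs.wordProd l') (cs.wordProd l) :=
  bruhatLE_iff_bruhatChain.mpr (bruhatChain_of_sublist hl h)

theorem bruhatLE.trans {cs : CoxeterSystem M W} {u v w : W} (h₁ : bruhatLE cs u v)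
    (h₂ : bruhatLE cs v w) : bruhatLE cs u w := by
  rw [bruhatLE_iff_bruhatChain] at *
  exact Relation.ReflTransGen.trans h₁ h₂

theorem bruhatLE.inv {cs : CoxeterSystem M W} {u w : W} (h : bruhatLE cs u w) :
    bruhatLE cs u⁻¹ w⁻¹ := by
  intro l hl hw
  obtain ⟨l', hs, hp⟩ := h l.reverse hl.reverse (by rw [cs.wordProd_reverse, hw, inv_inv])
  exact ⟨l'.reverse, by simpa using hs.reverse, by rw [cs.wordProd_reverse, hp]⟩

theorem bruhatLE_mul_simple {cs : CoxeterSystem M W} {w : W} {i : B}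
    (h : ¬ cs.IsRightDescent w i) : bruhatLE cs w (w * cs.simple i) :=
  bruhatLE_iff_bruhatChain.mpr <| Relation.ReflTransGen.single <| bruhatStep_mul_simple <| by
    have := cs.not_isRightDescent_iff.mp h
    omega

theorem mul_simple_bruhatLE {cs : CoxeterSystem M W} {w : W} {i : B}
    (h : cs.IsRightDescent w i) : bruhatLE cs (w * cs.simple i) w := by
  have := bruhatLE_mul_simple (cs.isRightDescent_iff_not_isRightDescent_mul.mp h)
  simpa [mul_assoc] using this

theorem simple_mul_bruhatLE {cs : CoxeterSystem M W} {w : W} {i : B}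
    (h : cs.IsLeftDescent w i) : bruhatLE cs (cs.simple i * w) w := by
  have := (mul_simple_bruhatLE (cs.isRightDescent_inv_iff.mpr h)).inv
  simpa using this

theorem bruhatLE.or_mul_simple {cs : CoxeterSystem M W} {u w : W} {i : B} (h : bruhatLE cs u w)
    (hw : cs.IsRightDescent w i) :
    bruhatLE cs u (w * cs.simple i) ∨ bruhatLE cs (u * cs.simple i) (w * cs.simple i) := by
  obtain ⟨m, hm, hmw, hr, hp⟩ := exists_isReduced_concat hw
  obtain ⟨l, hs, rfl⟩ := h _ hr hp
  obtain ⟨l₁, l₂, rfl, h₁, h₂⟩ := List.sublist_append_iff.mp hs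
  rw [← hmw]
  rcases List.sublist_singleton.mp h₂ with rfl | rfl
  · left
    simpa using bruhatLE_of_sublist hm h₁
  · right
    simpa [cs.wordProd_append, mul_assoc] using bruhatLE_of_sublist hm h₁

theorem bruhatLE.mul_simple_mul_simple {cs : CoxeterSystem M W} {u w : W} {i : B}
    (h : bruhatLE cs u w) (hw : cs.IsRightDescent w i) (hu : cs.IsRightDescent u i) :
    bruhatLE cs (u * cs.simple i) (w * cs.simple i) :=
  (h.or_mul_simple hw).elim (mul_simple_bruhatLE hu).trans id

theorem bruhatLE.le_mul_simple {cs : CoxeterSystem M W} {u w : W} {i : B}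
    (h : bruhatLE cs u w) (hw : cs.IsRightDescent w i) (hu : ¬ cs.IsRightDescent u i) :
    bruhatLE cs u (w * cs.simple i) :=
  (h.or_mul_simple hw).elim id (bruhatLE_mul_simple hu).trans

theorem bruhatLE.mul_simple_le {cs : CoxeterSystem M W} {u w : W} {i : B}
    (h : bruhatLE cs u w) (hw : cs.IsRightDescent w i) : bruhatLE cs (u * cs.simple i) w := by
  by_cases hu : cs.IsRightDescent u i
  · exact (mul_simple_bruhatLE hu).trans h
  · obtain ⟨m, hm, hmw, hr, hp⟩ := exists_isReduced_concat hw
    obtain ⟨l, hs, rfl⟩ := h.le_mul_simple hw hu m hm hmw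
    rw [← hp, ← cs.wordProd_singleton, ← cs.wordProd_append]
    exact bruhatLE_of_sublist hr (hs.append (List.Sublist.refl _))

theorem bruhatLE.simple_mul_simple_mul {cs : CoxeterSystem M W} {u w : W} {i : B}
    (h : bruhatLE cs u w) (hw : cs.IsLeftDescent w i) (hu : cs.IsLeftDescent u i) :
    bruhatLE cs (cs.simple i * u) (cs.simple i * w) := by
  have := (h.inv.mul_simple_mul_simple (cs.isRightDescent_inv_iff.mpr hw)
    (cs.isRightDescent_inv_iff.mpr hu)).inv
  simpa using this

theorem bruhatLE.le_simple_mul {cs : CoxeterSystem M W} {u w : W} {i : B}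
    (h : bruhatLE cs u w) (hw : cs.IsLeftDescent w i) (hu : ¬ cs.IsLeftDescent u i) :
    bruhatLE cs u (cs.simple i * w) := by
  have := (h.inv.le_mul_simple (cs.isRightDescent_inv_iff.mpr hw)
    (cs.isRightDescent_inv_iff.not.mpr hu)).inv
  simpa using this

theorem bruhatLE.simple_mul_le {cs : CoxeterSystem M W} {u w : W} {i : B}
    (h : bruhatLE cs u w) (hw : cs.IsLeftDescent w i) : bruhatLE cs (cs.simple i * u) w := by
  have := (h.inv.mul_simple_le (cs.isRightDescent_inv_iff.mpr hw)).inv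
  simpa using this

theorem isLeftDescent_mul_simple {cs : CoxeterSystem M W} {w : W} {i j : B}
    (hi : cs.IsRightDescent w i) (hj : cs.IsLeftDescent w j)
    (hne : cs.simple j * w * cs.simple i ≠ w) : cs.IsLeftDescent (w * cs.simple i) j := by
  have ht : cs.IsReflection (w⁻¹ * cs.simple j * w) := by
    simpa using (cs.isReflection_simple j).conj w⁻¹
  have hwt : w * (w⁻¹ * cs.simple j * w) = cs.simple j * w := by simp [mul_assoc]
  have h := eq_or_length_mul_mul_simple hi ht (by rwa [hwt])
  rw [hwt] at h
  have h' := h.resolve_left fun h => hne (by simp [h, mul_assoc])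
  have h1 := cs.isRightDescent_iff.mp hi
  unfold CoxeterSystem.IsLeftDescent
  rw [← mul_assoc]
  omega

theorem length_map_of_involutive {cs : CoxeterSystem M W} {θ : W ≃* W}
    (hθ : Function.Involutive θ) (hθS : ∀ i : B, ∃ j : B, θ (cs.simple i) = cs.simple j) (w : W) :
    cs.length (θ w) = cs.length w := by
  choose f hf using hθS
  have hle : ∀ w, cs.length (θ w) ≤ cs.length w := by
    intro w
    obtain ⟨l, hl, rfl⟩ := cs.exists_isReduced w
    have : θ (cs.wordProd l) = cs.wordProd (l.map f) := by
      induction l with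
      | nil => simp
      | cons a l ih =>
        rw [List.map_cons, cs.wordProd_cons, cs.wordProd_cons, map_mul, hf,
          ih (by simpa using hl.drop 1)]
    rw [this, hl.eq]
    simpa using cs.length_wordProd_le (l.map f)
  refine le_antisymm (hle w) ?_
  simpa [hθ w] using hle (θ w)

theorem isLeftDescent_iff_of_mem_twistedInvolutions {cs : CoxeterSystem M W} {θ : W ≃* W}
    (hθ : Function.Involutive θ) (hθS : ∀ i : B, ∃ j : B, θ (cs.simple i) = cs.simple j)
    {w : W} (hw : w ∈ twistedInvolutions θ) {i j : B} (hj : θ (cs.simple i) = cs.simple j) :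
    cs.IsLeftDescent w j ↔ cs.IsRightDescent w i := by
  have hw' : θ w = w⁻¹ := hw
  have h : θ (cs.simple j * w) = (w * cs.simple i)⁻¹ := by
    rw [map_mul, ← hj, hθ, hw', mul_inv_rev, cs.inv_simple]
  unfold CoxeterSystem.IsLeftDescent CoxeterSystem.IsRightDescent
  rw [← length_map_of_involutive hθ hθS (cs.simple j * w), h, cs.length_inv]

theorem statement3 [Finite B] (cs : CoxeterSystem M W) (θ : W ≃* W)
    (hθ : Function.Involutive θ)
    (hθS : ∀ i : B, ∃ j : B, θ (cs.simple i) = cs.simple j)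
    (i : B) (u w : W)
    (hu : u ∈ twistedInvolutions θ) (hw : w ∈ twistedInvolutions θ)
    (huw : bruhatLE cs u w) (hi : cs.IsRightDescent w i) :
    bruhatLE cs (twistAct cs θ u i) w ∧
    (cs.IsRightDescent u i → bruhatLE cs (twistAct cs θ u i) (twistAct cs θ w i)) ∧
    (¬ cs.IsRightDescent u i → bruhatLE cs u (twistAct cs θ w i)) := by
  obtain ⟨j, hj⟩ := hθS i
  have hdu := isLeftDescent_iff_of_mem_twistedInvolutions hθ hθS hu hj
  have hwj := (isLeftDescent_iff_of_mem_twistedInvolutions hθ hθS hw hj).mpr hi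
  unfold twistAct
  rw [hj]
  refine ⟨?_, fun hui => ?_, fun hui => ?_⟩
  · split_ifs
    · exact huw.mul_simple_le hi
    · rw [mul_assoc]
      exact (huw.mul_simple_le hi).simple_mul_le hwj
  · have hus := huw.mul_simple_mul_simple hi hui
    split_ifs with h₁ h₂ h₂
    · exact hus
    · rw [mul_assoc (cs.simple j)]
      refine hus.le_simple_mul (isLeftDescent_mul_simple hi hwj h₂) ?_
      unfold CoxeterSystem.IsLeftDescent
      rw [← mul_assoc, h₁]
      exact hui.not_gt
    · rw [mul_assoc (cs.simple j)]
      exact (simple_mul_bruhatLE (isLeftDescent_mul_simple hui (hdu.mpr hui) h₁)).trans hus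
    · rw [mul_assoc (cs.simple j), mul_assoc (cs.simple j)]
      exact hus.simple_mul_simple_mul (isLeftDescent_mul_simple hi hwj h₂)
        (isLeftDescent_mul_simple hui (hdu.mpr hui) h₁)
  · have hus := huw.le_mul_simple hi hui
    split_ifs with h₁
    · exact hus
    · rw [mul_assoc]
      exact hus.le_simple_mul (isLeftDescent_mul_simple hi hwj h₁) (hdu.not.mpr hui)

end TwistedIdentitiesPaper
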